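/- arXiv:2412.05001 — 3 statements merged into one kernel-verified Lean document; each statement's English description precedes it below -/
import Mathlib

section
/- Let n ≥ 2 and let α : [0,∞) → [0,∞) be continuous with compact support and not identically zero. Then there exist t₁, t₂ ≥ 0 such that (∫_{dom(u_{t₁} □ u_{t₂})} α(|∇(u_{t₁} □ u_{t₂})(x)|) dx)^{1/n} < (∫_{dom(u_{t₁})} α(|∇u_{t₁}(x)|) dx)^{1/n} + (∫_{dom(u_{t₂})} α(|∇u_{t₂}(x)|) dx)^{1/n}. (Failure of the Brunn–Minkowski-type inequality for the n-th functional intrinsic volume V̄ₙ^α(u) = ∫_{dom(u)} α(|∇u(x)|) dx.) -/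
open MeasureTheory Filter Topology

noncomputable section

abbrev En (n : ℕ) : Type := EuclideanSpace ℝ (Fin n)

/-- The effective domain of an extended-real-valued function. -/
def domFn {n : ℕ} (u : En n → EReal) : Set (En n) := {x | u x ≠ ⊤}

/-- Infimal convolution. -/
def infConv {n : ℕ} (u v : En n → EReal) : En n → EReal :=
  fun x => ⨅ y : En n, u y + v (x - y)

/-- The (a.e. defined) gradient of an extended-real-valued function, via its real part. -/
def gradFn {n : ℕ} (u : En n → EReal) (x : En n) : En n :=
  gradient (fun y => (u y).toReal) x

/-- The function `u_t`: equal to `t‖x‖` on the unit ball, `∞` outside. -/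
def ut {n : ℕ} (t : ℝ) : En n → EReal :=
  fun x => if ‖x‖ ≤ 1 then ((t * ‖x‖ : ℝ) : EReal) else ⊤

theorem norm_gradFn_of_eventuallyEq {n : ℕ} {u : En n → EReal} {x : En n} (hx : x ≠ 0)
    {c t : ℝ} (ht : 0 ≤ t) (h : ∀ᶠ y in 𝓝 x, u y = ((c + t * ‖y‖ : ℝ) : EReal)) :
    ‖gradFn u x‖ = t := by
  have : Nontrivial (En n) := ⟨x, 0, hx⟩
  have hd : DifferentiableAt ℝ (fun y : En n => ‖y‖) x := differentiableAt_id.norm ℝ hx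
  have he : (fun y => (u y).toReal) =ᶠ[𝓝 x] fun y => c + t * ‖y‖ := by
    filter_upwards [h] with y hy
    rw [hy, EReal.toReal_coe]
  rw [gradFn, gradient, LinearIsometryEquiv.norm_map, he.fderiv_eq, fderiv_const_add,
    fderiv_const_mul hd, norm_smul, norm_fderiv_norm hd, mul_one, Real.norm_of_nonneg ht]

theorem infConv_ut_of_norm_le_one {n : ℕ} {s t : ℝ} (hs : 0 ≤ s) (hst : s ≤ t) {x : En n}
    (hx : ‖x‖ ≤ 1) : infConv (ut s) (ut t) x = ((s * ‖x‖ : ℝ) : EReal) := by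
  apply le_antisymm
  · refine (iInf_le _ x).trans ?_
    simp [ut, hx]
  · refine le_iInf fun y => ?_
    have hr : ‖x‖ ≤ ‖y‖ + ‖x - y‖ := by simpa using norm_add_le y (x - y)
    unfold ut
    split_ifs with h1 h2
    · rw [← EReal.coe_add, EReal.coe_le_coe_iff]
      nlinarith [norm_nonneg (x - y)]
    all_goals simp [-EReal.coe_mul]

theorem infConv_ut_of_one_le_norm {n : ℕ} {s t : ℝ} (hst : s ≤ t) (ht : 0 ≤ t) {x : En n}
    (hx : 1 ≤ ‖x‖) (hx2 : ‖x‖ ≤ 2) :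
    infConv (ut s) (ut t) x = ((s - t + t * ‖x‖ : ℝ) : EReal) := by
  apply le_antisymm
  · refine (iInf_le _ (‖x‖⁻¹ • x)).trans ?_
    have h0 : ‖x‖ ≠ 0 := by positivity
    have h1 : ‖‖x‖⁻¹ • x‖ = 1 := by
      rw [norm_smul, norm_inv, norm_norm, inv_mul_cancel₀ h0]
    have h2 : ‖x - ‖x‖⁻¹ • x‖ = ‖x‖ - 1 := by
      have : x - ‖x‖⁻¹ • x = (1 - ‖x‖⁻¹) • x := by rw [sub_smul, one_smul]
      rw [this, norm_smul, Real.norm_of_nonneg (sub_nonneg.2 (inv_le_one_of_one_le₀ hx)), sub_mul,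
        inv_mul_cancel₀ h0, one_mul]
    rw [ut, ut, h1, h2, if_pos le_rfl, if_pos (by linarith), ← EReal.coe_add,
      EReal.coe_le_coe_iff]
    linarith
  · refine le_iInf fun y => ?_
    have hr : ‖x‖ ≤ ‖y‖ + ‖x - y‖ := by simpa using norm_add_le y (x - y)
    unfold ut
    split_ifs with h1 h2
    · rw [← EReal.coe_add, EReal.coe_le_coe_iff]
      nlinarith [norm_nonneg (x - y)]
    all_goals simp [-EReal.coe_mul]

theorem infConv_ut_of_two_lt_norm {n : ℕ} {s t : ℝ} {x : En n} (hx : 2 < ‖x‖) :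
    infConv (ut s) (ut t) x = ⊤ := by
  refine iInf_eq_top.2 fun y => ?_
  have hr : ‖x‖ ≤ ‖y‖ + ‖x - y‖ := by simpa using norm_add_le y (x - y)
  unfold ut
  split_ifs with h1 h2
  · linarith
  all_goals simp [-EReal.coe_mul]

theorem domFn_ut {n : ℕ} (t : ℝ) : domFn (ut t : En n → EReal) = Metric.closedBall 0 1 := by
  ext x
  rw [mem_closedBall_zero_iff, domFn, Set.mem_ofPred_eq, ut]
  split_ifs with h <;> simp [h, -EReal.coe_mul]

theorem domFn_infConv_ut {n : ℕ} {s t : ℝ} (hs : 0 ≤ s) (hst : s ≤ t) :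
    domFn (infConv (ut s) (ut t) : En n → EReal) = Metric.closedBall 0 2 := by
  ext x
  rw [mem_closedBall_zero_iff, domFn, Set.mem_ofPred_eq]
  rcases le_or_gt ‖x‖ 2 with h2 | h2
  · rcases le_total ‖x‖ 1 with h1 | h1
    · simp [infConv_ut_of_norm_le_one hs hst h1, h2, -EReal.coe_mul]
    · simp only [infConv_ut_of_one_le_norm hst (hs.trans hst) h1 h2, h2, iff_true]
      exact EReal.coe_ne_top _
  · simp [infConv_ut_of_two_lt_norm h2, h2]

theorem setIntegral_ball_of_eq {n : ℕ} (hn : 2 ≤ n) {g : En n → ℝ} {A : ℝ}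
    (hA : ∀ x, x ≠ 0 → ‖x‖ < 1 → g x = A) :
    ∫ x in Metric.ball 0 1, g x = volume.real (Metric.ball (0 : En n) 1) * A := by
  have : Nonempty (Fin n) := ⟨⟨0, by omega⟩⟩
  have h0 : ∀ᵐ x : En n, x ≠ 0 := by simp [ae_iff]
  have : ∫ x in Metric.ball 0 1, g x = ∫ _ in Metric.ball (0 : En n) 1, A := by
    refine setIntegral_congr_ae measurableSet_ball ?_
    filter_upwards [h0] with x hx hx1
    exact hA x hx (by simpa using hx1)
  rw [this, setIntegral_const, smul_eq_mul]

theorem setIntegral_ball_two_of_eq {n : ℕ} (hn : 2 ≤ n) {g : En n → ℝ} {A B : ℝ}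
    (hA : ∀ x, x ≠ 0 → ‖x‖ < 1 → g x = A) (hB : ∀ x, 1 < ‖x‖ → ‖x‖ < 2 → g x = B) :
    ∫ x in Metric.ball 0 2, g x
      = volume.real (Metric.ball (0 : En n) 1) * (A + (2 ^ n - 1) * B) := by
  have : Nonempty (Fin n) := ⟨⟨0, by omega⟩⟩
  have h0 : ∀ᵐ x : En n, x ≠ 0 := by simp [ae_iff]
  have h1 : ∀ᵐ x : En n, ‖x‖ ≠ 1 := by
    have := Measure.addHaar_sphere (volume : Measure (En n)) 0 1
    rw [ae_iff]
    convert this using 2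
    ext x
    simp
  have h2 : volume.real (Metric.ball (0 : En n) 2)
      = 2 ^ n * volume.real (Metric.ball (0 : En n) 1) := by
    rw [measureReal_def, Measure.addHaar_ball _ _ (zero_le_two : (0 : ℝ) ≤ 2), ENNReal.toReal_mul,
      ENNReal.toReal_ofReal (by positivity), finrank_euclideanSpace_fin, measureReal_def]
  have hsub : Metric.ball (0 : En n) 1 ⊆ Metric.ball 0 2 := Metric.ball_subset_ball (by norm_num)
  have key : ∫ x in Metric.ball 0 2, g x = ∫ x in Metric.ball (0 : En n) 2,
      ((Metric.ball (0 : En n) 1).indicator (fun _ => A - B) x + B) := by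
    refine setIntegral_congr_ae measurableSet_ball ?_
    filter_upwards [h0, h1] with x hx hx1 hx2
    rw [mem_ball_zero_iff] at hx2
    rcases lt_or_gt_of_ne hx1 with h | h
    · rw [Set.indicator_of_mem (by simpa using h), hA x hx h, sub_add_cancel]
    · rw [Set.indicator_of_notMem (by simpa using h.le), hB x h hx2, zero_add]
  have hfin : volume (Metric.ball (0 : En n) 2) ≠ ⊤ := measure_ball_lt_top.ne
  have hind : IntegrableOn ((Metric.ball (0 : En n) 1).indicator fun _ => A - B)
      (Metric.ball 0 2) := (integrableOn_const hfin).indicator measurableSet_ball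
  rw [key, integral_add hind (integrableOn_const hfin), setIntegral_indicator measurableSet_ball,
    Set.inter_eq_right.2 hsub, setIntegral_const, setIntegral_const, h2]
  simp only [smul_eq_mul]
  ring

theorem pow_add_two_pow_sub_one_mul_pow_lt {a b : ℝ} (hb : 0 < b) (hab : b < a) {n : ℕ}
    (hn : 2 ≤ n) : a ^ n + (2 ^ n - 1) * b ^ n < (a + b) ^ n := by
  induction n, hn using Nat.le_induction with
  | base => nlinarith
  | succ n hn ih =>
    have h1 : b ^ n ≤ a ^ n := pow_le_pow_left₀ hb.le hab.le n
    have h2 : (1 : ℝ) ≤ 2 ^ n := one_le_pow₀ (by norm_num)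
    have h3 : 0 ≤ (2 ^ n - 1 : ℝ) * b ^ n * (a - b) := by
      have := sub_nonneg.2 h2
      have := sub_nonneg.2 hab.le
      positivity
    have h4 : 0 ≤ b * (a ^ n - b ^ n) := mul_nonneg hb.le (sub_nonneg.2 h1)
    have h5 := mul_lt_mul_of_pos_left ih (by linarith : 0 < a + b)
    calc a ^ (n + 1) + (2 ^ (n + 1) - 1) * b ^ (n + 1)
        = (a + b) * (a ^ n + (2 ^ n - 1) * b ^ n)
          - (2 ^ n - 1 : ℝ) * b ^ n * (a - b) - b * (a ^ n - b ^ n) := by ring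
      _ < (a + b) * (a + b) ^ n := by linarith
      _ = (a + b) ^ (n + 1) := by ring

theorem rpow_add_two_pow_sub_one_mul_lt {n : ℕ} (hn : 2 ≤ n) {κ A B : ℝ} (hκ : 0 < κ) (hB : 0 < B)
    (hBA : B < A) :
    (κ * (A + (2 ^ n - 1) * B)) ^ ((1 : ℝ) / n)
      < (κ * A) ^ ((1 : ℝ) / n) + (κ * B) ^ ((1 : ℝ) / n) := by
  have hn0 : n ≠ 0 := by omega
  have hp : (0 : ℝ) < 1 / n := by positivity
  have hA : 0 < A := hB.trans hBA
  have root_pow : ∀ C : ℝ, 0 < C → (C ^ ((1 : ℝ) / n)) ^ n = C := fun C hC => by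
    rw [one_div, Real.rpow_inv_natCast_pow hC.le hn0]
  have h2 : (1 : ℝ) ≤ 2 ^ n := one_le_pow₀ (by norm_num)
  have h3 : 0 < A + (2 ^ n - 1) * B := by
    have := mul_nonneg (sub_nonneg.2 h2) hB.le
    linarith
  have key := pow_add_two_pow_sub_one_mul_pow_lt (Real.rpow_pos_of_pos (mul_pos hκ hB) (1 / n))
    (Real.rpow_lt_rpow (mul_pos hκ hB).le (mul_lt_mul_of_pos_left hBA hκ) hp) hn
  rw [root_pow _ (mul_pos hκ hB), root_pow _ (mul_pos hκ hA)] at key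
  refine lt_of_pow_lt_pow_left₀ n (by positivity) ?_
  rw [root_pow _ (mul_pos hκ h3)]
  linarith

theorem setIntegral_ut {n : ℕ} (hn : 2 ≤ n) (α : ℝ → ℝ) {t : ℝ} (ht : 0 ≤ t) :
    ∫ x in interior (domFn (ut t : En n → EReal)), α ‖gradFn (ut t) x‖
      = volume.real (Metric.ball (0 : En n) 1) * α t := by
  rw [domFn_ut, interior_closedBall _ one_ne_zero]
  refine setIntegral_ball_of_eq hn fun x hx hx1 => ?_
  rw [norm_gradFn_of_eventuallyEq hx (c := 0) ht]
  filter_upwards [continuous_norm.continuousAt.eventually_lt_const hx1] with y hy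
  rw [ut, if_pos hy.le, zero_add]

theorem setIntegral_infConv_ut {n : ℕ} (hn : 2 ≤ n) (α : ℝ → ℝ) {s t : ℝ} (hs : 0 ≤ s)
    (hst : s ≤ t) :
    ∫ x in interior (domFn (infConv (ut s) (ut t) : En n → EReal)),
        α ‖gradFn (infConv (ut s) (ut t)) x‖
      = volume.real (Metric.ball (0 : En n) 1) * (α s + (2 ^ n - 1) * α t) := by
  rw [domFn_infConv_ut hs hst, interior_closedBall _ two_ne_zero]
  refine setIntegral_ball_two_of_eq hn (fun x hx hx1 => ?_) fun x hx1 hx2 => ?_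
  · rw [norm_gradFn_of_eventuallyEq hx (c := 0) hs]
    filter_upwards [continuous_norm.continuousAt.eventually_lt_const hx1] with y hy
    rw [infConv_ut_of_norm_le_one hs hst hy.le, zero_add]
  · have hx : x ≠ 0 := norm_pos_iff.1 (zero_lt_one.trans hx1)
    rw [norm_gradFn_of_eventuallyEq hx (c := s - t) (hs.trans hst)]
    filter_upwards [continuous_norm.continuousAt.eventually_lt_const hx2,
      continuous_norm.continuousAt.eventually_const_lt hx1] with y hy2 hy1
    exact infConv_ut_of_one_le_norm hst (hs.trans hst) hy1.le hy2.le

/-- Failure of the Brunn–Minkowski inequality for the `n`-th functional intrinsic volume. -/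
theorem stmt0 (n : ℕ) (hn : 2 ≤ n) (α : ℝ → ℝ)
    (hcont : ContinuousOn α (Set.Ici 0))
    (hnonneg : ∀ t : ℝ, 0 ≤ t → 0 ≤ α t)
    (hsupp : ∃ T : ℝ, ∀ t : ℝ, T ≤ t → α t = 0)
    (hne : ∃ t : ℝ, 0 ≤ t ∧ α t ≠ 0) :
    ∃ t₁ t₂ : ℝ, 0 ≤ t₁ ∧ 0 ≤ t₂ ∧
      (∫ x in interior (domFn (infConv (ut t₁) (ut t₂ : En n → EReal))),
          α ‖gradFn (infConv (ut t₁) (ut t₂)) x‖) ^ ((1 : ℝ) / n)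
        < (∫ x in interior (domFn (ut t₁ : En n → EReal)), α ‖gradFn (ut t₁) x‖) ^ ((1 : ℝ) / n)
          + (∫ x in interior (domFn (ut t₂ : En n → EReal)), α ‖gradFn (ut t₂) x‖) ^ ((1 : ℝ) / n) := by
  obtain ⟨T, hT⟩ := hsupp
  obtain ⟨s, hs, hαs⟩ := hne
  have hpos : 0 < α s := lt_of_le_of_ne (hnonneg s hs) hαs.symm
  obtain ⟨t, ⟨hst, -⟩, hαt⟩ : α s / 2 ∈ α '' Set.Icc s (max s T) := by
    refine intermediate_value_Icc' (le_max_left s T)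
      (hcont.mono fun x hx => hs.trans hx.1) ⟨?_, by linarith⟩
    rw [hT _ (le_max_right s T)]
    positivity
  refine ⟨s, t, hs, hs.trans hst, ?_⟩
  rw [setIntegral_infConv_ut hn α hs hst, setIntegral_ut hn α hs,
    setIntegral_ut hn α (hs.trans hst)]
  have hκ : 0 < volume.real (Metric.ball (0 : En n) 1) :=
    ENNReal.toReal_pos (Metric.measure_ball_pos _ _ one_pos).ne' measure_ball_lt_top.ne
  exact rpow_add_two_pow_sub_one_mul_lt hn hκ (by linarith) (by linarith)
end
end

section
/- For all 0 ≤ t₁ ≤ t₂ and all x ∈ ℝⁿ one has (u_{t₁} □ u_{t₂})(x) = t₁|x| if |x| ≤ 1, (u_{t₁} □ u_{t₂})(x) = t₂(|x| − 1) + t₁ if 1 < |x| ≤ 2, and (u_{t₁} □ u_{t₂})(x) = ∞ if |x| > 2. -/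
open MeasureTheory Filter Topology

noncomputable section

theorem ut_of_norm_le_one {n : ℕ} (t : ℝ) {x : En n} (hx : ‖x‖ ≤ 1) :
    ut t x = ((t * ‖x‖ : ℝ) : EReal) := if_pos hx

theorem ut_of_one_lt_norm {n : ℕ} (t : ℝ) {x : En n} (hx : 1 < ‖x‖) : ut t x = ⊤ :=
  if_neg hx.not_ge

theorem ut_ne_bot {n : ℕ} (t : ℝ) (x : En n) : ut t x ≠ ⊥ := by
  unfold ut
  split_ifs
  · exact EReal.coe_ne_bot _
  · exact top_ne_bot

theorem infConv_le {n : ℕ} (u v : En n → EReal) (x y : En n) :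
    infConv u v x ≤ u y + v (x - y) := iInf_le _ y

/-- To bound `u_{t₁} □ u_{t₂}` below it suffices to consider decompositions
`x = y + (x - y)` with both parts in the unit ball. -/
theorem le_infConv_ut {n : ℕ} {t₁ t₂ : ℝ} {x : En n} {c : EReal}
    (h : ∀ y : En n, ‖y‖ ≤ 1 → ‖x - y‖ ≤ 1 →
      c ≤ ((t₁ * ‖y‖ + t₂ * ‖x - y‖ : ℝ) : EReal)) :
    c ≤ infConv (ut t₁) (ut t₂) x := by
  refine le_iInf fun y => ?_
  rcases le_or_gt ‖y‖ 1 with hy | hy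
  · rcases le_or_gt ‖x - y‖ 1 with hxy | hxy
    · rw [ut_of_norm_le_one _ hy, ut_of_norm_le_one _ hxy, ← EReal.coe_add]
      exact h y hy hxy
    · rw [ut_of_one_lt_norm _ hxy, EReal.add_top_of_ne_bot (ut_ne_bot _ _)]
      exact le_top
  · rw [ut_of_one_lt_norm _ hy, EReal.top_add_of_ne_bot (ut_ne_bot _ _)]
    exact le_top

/-- Explicit formula for the infimal convolution `u_{t₁} □ u_{t₂}`. -/
theorem stmt1 (n : ℕ) (hn : 1 ≤ n) (t₁ t₂ : ℝ) (ht₁ : 0 ≤ t₁) (ht : t₁ ≤ t₂) (x : En n) :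
    (‖x‖ ≤ 1 → infConv (ut t₁) (ut t₂) x = ((t₁ * ‖x‖ : ℝ) : EReal)) ∧
    (1 < ‖x‖ → ‖x‖ ≤ 2 → infConv (ut t₁) (ut t₂) x = ((t₂ * (‖x‖ - 1) + t₁ : ℝ) : EReal)) ∧
    (2 < ‖x‖ → infConv (ut t₁) (ut t₂) x = ⊤) := by
  have tri (y : En n) : ‖x‖ ≤ ‖y‖ + ‖x - y‖ := by
    simpa using norm_add_le y (x - y)
  refine ⟨fun hx => le_antisymm ?_ ?_, fun hx hx2 => le_antisymm ?_ ?_, fun hx => ?_⟩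
  · refine (infConv_le _ _ x x).trans_eq ?_
    rw [ut_of_norm_le_one _ hx, ut_of_norm_le_one _ (by simp)]
    simp
  · refine le_infConv_ut fun y _ _ => EReal.coe_le_coe_iff.2 ?_
    nlinarith [tri y, norm_nonneg (x - y)]
  · have hx0 : ‖x‖ ≠ 0 := by positivity
    have hy : ‖‖x‖⁻¹ • x‖ = 1 := by
      rw [norm_smul, norm_inv, norm_norm, inv_mul_cancel₀ hx0]
    have hxy : ‖x - ‖x‖⁻¹ • x‖ = ‖x‖ - 1 := by
      have : x - ‖x‖⁻¹ • x = (1 - ‖x‖⁻¹) • x := by rw [sub_smul, one_smul]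
      rw [this, norm_smul, Real.norm_of_nonneg (sub_nonneg.2 (inv_le_one_of_one_le₀ hx.le)),
        sub_mul, one_mul, inv_mul_cancel₀ hx0]
    refine (infConv_le _ _ x (‖x‖⁻¹ • x)).trans_eq ?_
    rw [ut_of_norm_le_one _ hy.le, ut_of_norm_le_one _ (by linarith), hy, hxy,
      ← EReal.coe_add, mul_one, add_comm]
  · refine le_infConv_ut fun y hy _ => EReal.coe_le_coe_iff.2 ?_
    nlinarith [mul_le_mul_of_nonneg_left (tri y) (ht₁.trans ht),
      mul_nonneg (sub_nonneg.2 ht) (sub_nonneg.2 hy)]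
  · refine top_le_iff.1 (le_infConv_ut fun y hy hxy => ?_)
    linarith [tri y]
end
end

section
/- The maps u ↦ K^u and K ↦ ⌊K⌋ are mutually inverse bijections between Conv_0(ℝⁿ) and the set of nonempty compact convex subsets K ⊂ ℝ^{n+1} with refl_H(K) = K. Precisely: (i) for every u ∈ Conv_0(ℝⁿ), K^u is a nonempty compact convex set with refl_H(K^u) = K^u and ⌊K^u⌋ = u; (ii) for every nonempty compact convex K ⊂ ℝ^{n+1} with refl_H(K) = K, ⌊K⌋ ∈ Conv_0(ℝⁿ) and K^{⌊K⌋} = K. -/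
open MeasureTheory Filter Topology
open scoped Classical

noncomputable section

/-- The epigraph of an extended-real-valued function, as a subset of `ℝⁿ × ℝ`. -/
def epiSet {n : ℕ} (u : En n → EReal) : Set (En n × ℝ) :=
  {p | u p.1 ≤ (p.2 : EReal)}

/-- Convexity of an extended-real-valued function via its epigraph. -/
def IsConvexFn {n : ℕ} (u : En n → EReal) : Prop := Convex ℝ (epiSet u)

/-- Super-coercivity: `u(x)/‖x‖ → ∞` as `‖x‖ → ∞`. -/
def SuperCoercive {n : ℕ} (u : En n → EReal) : Prop :=
  ∀ c : ℝ, ∃ R : ℝ, ∀ x : En n, R ≤ ‖x‖ → ((c * ‖x‖ : ℝ) : EReal) ≤ u x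

/-- The class `Conv_sc(ℝⁿ)` of proper, l.s.c., super-coercive convex functions
with values in `(-∞,∞]`. -/
def ConvSc {n : ℕ} (u : En n → EReal) : Prop :=
  IsConvexFn u ∧ LowerSemicontinuous u ∧ (∀ x, u x ≠ ⊥) ∧ (∃ x, u x ≠ ⊤) ∧ SuperCoercive u

/-- The class `Conv_cd(ℝⁿ)`: members of `Conv_sc(ℝⁿ)` with compact domain. -/
def ConvCd {n : ℕ} (u : En n → EReal) : Prop :=
  ConvSc u ∧ IsCompact (domFn u)

/-- The class `Conv_0(ℝⁿ)`: members of `Conv_cd(ℝⁿ)` that are non-positive on their domain. -/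
def Conv0 {n : ℕ} (u : En n → EReal) : Prop :=
  ConvCd u ∧ ∀ x ∈ domFn u, u x ≤ 0

/-- Reflection at the hyperplane `H = e_{n+1}^⊥`, identified with `ℝⁿ × ℝ ∋ (x,t) ↦ (x,-t)`. -/
def reflH {n : ℕ} (p : En n × ℝ) : En n × ℝ := (p.1, -p.2)

/-- The convex body `K^u = epi(u) ∩ refl_H(epi(u))` associated with `u ∈ Conv_0(ℝⁿ)`. -/
def Ku {n : ℕ} (u : En n → EReal) : Set (En n × ℝ) :=
  epiSet u ∩ reflH '' epiSet u

/-- The function `⌊K⌋` associated with a set `K ⊂ ℝⁿ × ℝ`. -/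
def floorFn {n : ℕ} (K : Set (En n × ℝ)) : En n → EReal :=
  fun x => if x ∈ Prod.fst '' K then ((sInf {t : ℝ | (x, t) ∈ K} : ℝ) : EReal) else ⊤

section Helpers

variable {n : ℕ}

lemma mem_image_reflH {S : Set (En n × ℝ)} {p : En n × ℝ} :
    p ∈ reflH '' S ↔ (p.1, -p.2) ∈ S := by
  constructor
  · rintro ⟨q, hq, rfl⟩
    simpa [reflH] using hq
  · intro h
    exact ⟨_, h, by simp [reflH]⟩

lemma mem_Ku {u : En n → EReal} {p : En n × ℝ} :
    p ∈ Ku u ↔ u p.1 ≤ (p.2 : EReal) ∧ u p.1 ≤ ((-p.2 : ℝ) : EReal) := by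
  rw [Ku, Set.mem_inter_iff, mem_image_reflH]
  rfl

lemma reflH_image_Ku (u : En n → EReal) : reflH '' Ku u = Ku u := by
  ext p
  simp only [mem_image_reflH, mem_Ku, neg_neg]
  exact and_comm

lemma convex_image_reflH {S : Set (En n × ℝ)} (hS : Convex ℝ S) : Convex ℝ (reflH '' S) := by
  intro p hp q hq a b ha hb hab
  rw [mem_image_reflH] at *
  convert hS hp hq ha hb hab using 1
  ext1
  · rfl
  · simp only [Prod.snd_add, Prod.smul_snd, smul_eq_mul]
    ring

lemma isClosed_epiSet {u : En n → EReal} (hu : LowerSemicontinuous u) :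
    IsClosed (epiSet u) :=
  hu.isClosed_epigraph.preimage
    (continuous_fst.prodMk (continuous_coe_real_ereal.comp continuous_snd))

lemma continuous_reflH : Continuous (reflH : En n × ℝ → En n × ℝ) :=
  continuous_fst.prodMk continuous_snd.neg

lemma isClosed_Ku {u : En n → EReal} (hu : LowerSemicontinuous u) : IsClosed (Ku u) := by
  have h : Ku u = epiSet u ∩ reflH ⁻¹' epiSet u := by
    ext p
    rw [Ku, Set.mem_inter_iff, mem_image_reflH]
    rfl
  rw [h]
  exact (isClosed_epiSet hu).inter ((isClosed_epiSet hu).preimage continuous_reflH)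

lemma ConvCd.exists_real_lower_bound {u : En n → EReal} (hu : ConvCd u) :
    ∃ m : ℝ, ∀ x, (m : EReal) ≤ u x := by
  obtain ⟨⟨-, hlsc, hbot, hne, -⟩, hcpt⟩ := hu
  obtain ⟨a, ha, hmin⟩ := (hlsc.lowerSemicontinuousOn (domFn u)).exists_isMinOn hne hcpt
  refine ⟨(u a).toReal, fun x => ?_⟩
  rw [EReal.coe_toReal ha (hbot a)]
  by_cases hx : u x = ⊤
  · simp [hx]
  · exact hmin hx

lemma ConvCd.isCompact_Ku {u : En n → EReal} (hu : ConvCd u) : IsCompact (Ku u) := by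
  obtain ⟨m, hm⟩ := hu.exists_real_lower_bound
  refine (hu.2.prod (isCompact_Icc (a := m) (b := -m))).of_isClosed_subset
    (isClosed_Ku hu.1.2.1) ?_
  intro p hp
  obtain ⟨h₁, h₂⟩ := mem_Ku.1 hp
  have h₃ := EReal.coe_le_coe_iff.1 ((hm p.1).trans h₁)
  have h₄ := EReal.coe_le_coe_iff.1 ((hm p.1).trans h₂)
  exact ⟨ne_top_of_le_ne_top (EReal.coe_ne_top _) h₁, h₃, by linarith⟩

lemma Conv0.mk_zero_mem_Ku {u : En n → EReal} (hu : Conv0 u) {x : En n} (hx : u x ≠ ⊤) :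
    (x, (0 : ℝ)) ∈ Ku u :=
  mem_Ku.2 (by simpa using hu.2 x hx)

lemma Conv0.floorFn_Ku {u : En n → EReal} (hu : Conv0 u) : floorFn (Ku u) = u := by
  funext x
  by_cases hx : u x = ⊤
  · rw [floorFn, if_neg, hx]
    rintro ⟨p, hp, rfl⟩
    exact ne_top_of_le_ne_top (EReal.coe_ne_top _) (mem_Ku.1 hp).1 hx
  · rw [floorFn, if_pos ⟨_, hu.mk_zero_mem_Ku hx, rfl⟩]
    have h0 : u x ≤ 0 := hu.2 x hx
    have hr := EReal.coe_toReal hx (hu.1.1.2.2.1 x)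
    set r := (u x).toReal
    have hslice : {t : ℝ | (x, t) ∈ Ku u} = Set.Icc r (-r) := by
      ext t
      simp only [Set.mem_ofPred_eq, mem_Ku, ← hr, EReal.coe_le_coe_iff, Set.mem_Icc]
      exact and_congr_right fun _ => le_neg
    have hr0 : r ≤ 0 := by
      rw [← hr] at h0
      exact_mod_cast h0
    rw [hslice, csInf_Icc (by linarith), hr]

lemma sInf_slice_mem {K : Set (En n × ℝ)} (hK : IsCompact K) {x : En n}
    (hx : x ∈ Prod.fst '' K) : (x, sInf {t : ℝ | (x, t) ∈ K}) ∈ K := by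
  have hcpt : IsCompact {t : ℝ | (x, t) ∈ K} := by
    refine (hK.image continuous_snd).of_isClosed_subset
      (hK.isClosed.preimage (Continuous.prodMk_right x)) ?_
    intro t ht
    exact ⟨_, ht, rfl⟩
  obtain ⟨p, hp, rfl⟩ := hx
  exact hcpt.sInf_mem ⟨p.2, hp⟩

lemma floorFn_le_coe_iff {K : Set (En n × ℝ)} (hK : IsCompact K) {x : En n} {t : ℝ} :
    floorFn K x ≤ (t : EReal) ↔ ∃ s ≤ t, (x, s) ∈ K := by
  constructor
  · intro h
    by_cases hx : x ∈ Prod.fst '' K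
    · rw [floorFn, if_pos hx, EReal.coe_le_coe_iff] at h
      exact ⟨_, h, sInf_slice_mem hK hx⟩
    · rw [floorFn, if_neg hx] at h
      exact absurd (top_le_iff.1 h) (EReal.coe_ne_top t)
  · rintro ⟨s, hst, hs⟩
    rw [floorFn, if_pos ⟨_, hs, rfl⟩, EReal.coe_le_coe_iff]
    have hbdd : BddBelow {r : ℝ | (x, r) ∈ K} := by
      refine (hK.image continuous_snd).bddBelow.mono ?_
      intro r hr
      exact ⟨_, hr, rfl⟩
    exact (csInf_le hbdd hs).trans hst

lemma domFn_floorFn (K : Set (En n × ℝ)) : domFn (floorFn K) = Prod.fst '' K := by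
  ext x
  change floorFn K x ≠ ⊤ ↔ _
  rw [floorFn]
  split_ifs with hx
  · exact iff_of_true (EReal.coe_ne_top _) hx
  · exact iff_of_false (fun h => h rfl) hx

lemma floorFn_ne_bot (K : Set (En n × ℝ)) (x : En n) : floorFn K x ≠ ⊥ := by
  rw [floorFn]
  split_ifs
  · exact EReal.coe_ne_bot _
  · exact top_ne_bot

lemma isConvexFn_floorFn {K : Set (En n × ℝ)} (hK : IsCompact K) (hconv : Convex ℝ K) :
    IsConvexFn (floorFn K) := by
  intro p hp q hq a b ha hb hab
  obtain ⟨s, hs, hsK⟩ := (floorFn_le_coe_iff hK).1 hp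
  obtain ⟨r, hr, hrK⟩ := (floorFn_le_coe_iff hK).1 hq
  refine (floorFn_le_coe_iff hK).2 ⟨a * s + b * r, ?_, hconv hsK hrK ha hb hab⟩
  simp only [Prod.snd_add, Prod.smul_snd, smul_eq_mul]
  gcongr

lemma lowerSemicontinuous_floorFn {K : Set (En n × ℝ)} (hK : IsCompact K) :
    LowerSemicontinuous (floorFn K) := by
  rw [lowerSemicontinuous_iff_isClosed_preimage]
  intro y
  induction y with
  | bot =>
    have h : floorFn K ⁻¹' Set.Iic ⊥ = ∅ := by
      ext x
      simp [floorFn_ne_bot]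
    rw [h]
    exact isClosed_empty
  | top => simp
  | coe t =>
    have h : floorFn K ⁻¹' Set.Iic (t : EReal) = Prod.fst '' (K ∩ {p | p.2 ≤ t}) := by
      ext x
      simp only [Set.mem_preimage, Set.mem_Iic, floorFn_le_coe_iff hK]
      constructor
      · rintro ⟨s, hs, hsK⟩
        exact ⟨_, ⟨hsK, hs⟩, rfl⟩
      · rintro ⟨p, ⟨hp, hpt⟩, rfl⟩
        exact ⟨p.2, hpt, hp⟩
    rw [h]
    exact ((hK.inter_right (isClosed_le continuous_snd continuous_const)).image
      continuous_fst).isClosed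

lemma superCoercive_floorFn {K : Set (En n × ℝ)} (hK : IsCompact K) :
    SuperCoercive (floorFn K) := by
  intro c
  obtain ⟨R, hR⟩ := (hK.image continuous_fst).isBounded.exists_norm_le
  refine ⟨R + 1, fun x hx => ?_⟩
  rw [floorFn, if_neg]
  · exact le_top
  · intro hxK
    linarith [hR x hxK]

lemma neg_snd_mem {K : Set (En n × ℝ)} (hsymm : reflH '' K = K) {x : En n} {t : ℝ}
    (h : (x, t) ∈ K) : (x, -t) ∈ K := by
  rw [← hsymm] at h
  exact mem_image_reflH.1 h

lemma conv0_floorFn {K : Set (En n × ℝ)} (hne : K.Nonempty) (hK : IsCompact K)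
    (hconv : Convex ℝ K) (hsymm : reflH '' K = K) : Conv0 (floorFn K) := by
  refine ⟨⟨⟨isConvexFn_floorFn hK hconv, lowerSemicontinuous_floorFn hK, floorFn_ne_bot K, ?_,
    superCoercive_floorFn hK⟩, ?_⟩, ?_⟩
  · change (domFn (floorFn K)).Nonempty
    rw [domFn_floorFn]
    exact hne.image _
  · rw [domFn_floorFn]
    exact hK.image continuous_fst
  · rw [domFn_floorFn]
    rintro x ⟨⟨x, t⟩, hp, rfl⟩
    rw [← EReal.coe_zero, floorFn_le_coe_iff hK]
    rcases le_total t 0 with h | h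
    · exact ⟨t, h, hp⟩
    · exact ⟨-t, by linarith, neg_snd_mem hsymm hp⟩

lemma Ku_floorFn {K : Set (En n × ℝ)} (hK : IsCompact K)
    (hconv : Convex ℝ K) (hsymm : reflH '' K = K) : Ku (floorFn K) = K := by
  ext ⟨x, t⟩
  rw [mem_Ku, floorFn_le_coe_iff hK, floorFn_le_coe_iff hK]
  constructor
  · rintro ⟨⟨s, hs, hsK⟩, r, hr, hrK⟩
    have hslice : Convex ℝ {t : ℝ | (x, t) ∈ K} := by
      intro t₁ h₁ t₂ h₂ a b ha hb hab
      have h := hconv h₁ h₂ ha hb hab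
      rwa [Prod.smul_mk, Prod.smul_mk, Prod.mk_add_mk, Convex.combo_self hab] at h
    exact hslice.ordConnected.out hsK (neg_snd_mem hsymm hrK) ⟨hs, by linarith⟩
  · intro h
    exact ⟨⟨t, le_rfl, h⟩, -t, le_rfl, neg_snd_mem hsymm h⟩

end Helpers

/-- `u ↦ K^u` and `K ↦ ⌊K⌋` are mutually inverse bijections between `Conv_0(ℝⁿ)` and the
nonempty compact convex subsets of `ℝ^{n+1}` symmetric with respect to `H`. -/
theorem stmt7 (n : ℕ) (hn : 1 ≤ n) :
    (∀ u : En n → EReal, Conv0 u →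
      (Ku u).Nonempty ∧ IsCompact (Ku u) ∧ Convex ℝ (Ku u) ∧ reflH '' Ku u = Ku u ∧
        floorFn (Ku u) = u) ∧
    (∀ K : Set (En n × ℝ), K.Nonempty → IsCompact K → Convex ℝ K → reflH '' K = K →
      Conv0 (floorFn K) ∧ Ku (floorFn K) = K) := by
  refine ⟨fun u hu => ?_, fun K hne hK hconv hsymm =>
    ⟨conv0_floorFn hne hK hconv hsymm, Ku_floorFn hK hconv hsymm⟩⟩
  obtain ⟨x, hx⟩ := hu.1.1.2.2.2.1
  have hepi : Convex ℝ (epiSet u) := hu.1.1.1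
  exact ⟨⟨_, hu.mk_zero_mem_Ku hx⟩, hu.1.isCompact_Ku, hepi.inter (convex_image_reflH hepi),
    reflH_image_Ku u, hu.floorFn_Ku⟩
end
end
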